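/- Every cycle of the permutation γ has odd cardinality: for every n ≥ 1 and every w ∈ D_n, there exists k ≥ 1 with γ^k(w) = w, and the least such k is odd. -/

import Mathlib

/-- The two-letter alphabet {a, b}. -/
inductive Letter : Type
  | a : Letter
  | b : Letter
deriving DecidableEq, BEq, Repr

/-- Words over the alphabet {a, b}. -/
abbrev Word := List Letter

/-- δ(w) = |w|_a − |w|_b. -/
def delta (w : Word) : ℤ := (w.count Letter.a : ℤ) - (w.count Letter.b : ℤ)

/-- A Dyck word: δ(w) = 0 and δ(p) ≥ 0 for every prefix p of w. -/
def IsDyck (w : Word) : Prop := delta w = 0 ∧ ∀ p : Word, p <+: w → 0 ≤ delta p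

/-- Membership in D_n: w = d·b with d a Dyck word of length 2n. -/
def InD (n : ℕ) (w : Word) : Prop :=
  ∃ d : Word, IsDyck d ∧ d.length = 2 * n ∧ w = d ++ [Letter.b]

/-- Exchanging the letters a and b. -/
def Letter.flip : Letter → Letter
  | .a => .b
  | .b => .a

/-- The complement w̄ of a word w. -/
def comp (w : Word) : Word := w.map Letter.flip

/-- Sym(w): the complement of the mirror (reversal) of w. -/
def sym (w : Word) : Word := comp w.reverse

/-- A palindrome: a word equal to its mirror. -/
def Palindrome (w : Word) : Prop := w.reverse = w

/-- w' is a conjugate of w: w = u·v and w' = v·u. -/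
def Conj (w w' : Word) : Prop := ∃ u v : Word, w = u ++ v ∧ w' = v ++ u

/-- u is the principal prefix of w: the shortest prefix of w with δ(u) maximal. -/
def IsPrincipalPrefix (u w : Word) : Prop :=
  u <+: w ∧ (∀ p : Word, p <+: w → delta p ≤ delta u) ∧
    (∀ p : Word, p <+: w → delta p = delta u → u.length ≤ p.length)

/-- The graph of the map γ: writing w = u·v·b with u the principal prefix of w,
    γ(w) = v̄·b·ū. -/
def GammaRel (w w' : Word) : Prop :=
  ∃ u v : Word, IsPrincipalPrefix u w ∧ w = u ++ v ++ [Letter.b] ∧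
    w' = comp v ++ [Letter.b] ++ comp u

/-- F_n: the fixed points of γ in D_n. -/
def InF (n : ℕ) (w : Word) : Prop := InD n w ∧ GammaRel w w

/-- F_γ = ⋃_{n ≥ 1} F_n. -/
def InFgamma (w : Word) : Prop := ∃ n : ℕ, 1 ≤ n ∧ InF n w

/-- x^y: concatenation of the word x with itself y times. -/
def wpow (x : Word) : ℕ → Word
  | 0 => []
  | k + 1 => x ++ wpow x k
/-- The length of the principal prefix of w (the shortest prefix with δ maximal). -/
noncomputable def ppLen (w : Word) : ℕ :=
  sInf {k : ℕ | ∀ i ≤ w.length, delta (w.take i) ≤ delta (w.take k)}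

/-- The map γ as a function: writing w = u·v·b with u the principal prefix of w,
    γ(w) = v̄·b·ū. -/
noncomputable def gammaFun (w : Word) : Word :=
  comp ((w.drop (ppLen w)).dropLast) ++ [Letter.b] ++ comp (w.take (ppLen w))

/-! ### The height function `delta` -/

theorem delta_nil : delta [] = 0 := rfl

theorem delta_cons_a (w : Word) : delta (Letter.a :: w) = delta w + 1 := by
  have h : (Letter.a == Letter.b) = false := rfl
  have h' : (Letter.a == Letter.a) = true := rfl
  simp only [delta, List.count_cons, h, h']
  push_cast
  simp
  ring

theorem delta_cons_b (w : Word) : delta (Letter.b :: w) = delta w - 1 := by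
  have h : (Letter.b == Letter.a) = false := rfl
  have h' : (Letter.b == Letter.b) = true := rfl
  simp only [delta, List.count_cons, h, h']
  push_cast
  simp
  ring

theorem delta_append (u v : Word) : delta (u ++ v) = delta u + delta v := by
  simp only [delta, List.count_append]
  push_cast
  ring

theorem comp_append (u v : Word) : comp (u ++ v) = comp u ++ comp v := List.map_append

theorem comp_cons (x : Letter) (v : Word) : comp (x :: v) = x.flip :: comp v := rfl

theorem comp_nil : comp [] = [] := rfl

theorem length_comp (w : Word) : (comp w).length = w.length := List.length_map _

theorem comp_take (w : Word) (i : ℕ) : comp (w.take i) = (comp w).take i := List.map_take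

theorem delta_comp (w : Word) : delta (comp w) = -delta w := by
  induction w with
  | nil => rfl
  | cons x w ih =>
    cases x <;> simp only [comp_cons, Letter.flip, delta_cons_a, delta_cons_b, ih] <;> ring

theorem delta_emod_two (w : Word) : delta w % 2 = (w.length : ℤ) % 2 := by
  induction w with
  | nil => rfl
  | cons x w ih =>
    cases x <;> simp only [delta_cons_a, delta_cons_b, List.length_cons] <;> push_cast <;> omega

theorem exists_of_prefix_append {p u v : Word} (h : p <+: u ++ v) :
    (p <+: u ∧ p ≠ u) ∨ ∃ q, q <+: v ∧ p = u ++ q := by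
  obtain ⟨t, ht⟩ := h
  rcases List.append_eq_append_iff.1 ht with ⟨s, rfl, rfl⟩ | ⟨s, rfl, rfl⟩
  · by_cases hs : s = []
    · subst hs
      exact Or.inr ⟨[], List.nil_prefix, by simp⟩
    · exact Or.inl ⟨List.prefix_append _ _, by simpa using hs⟩
  · exact Or.inr ⟨s, List.prefix_append _ _, rfl⟩

theorem exists_of_prefix_comp {p w : Word} (h : p <+: comp w) : ∃ q, q <+: w ∧ p = comp q := by
  refine ⟨w.take p.length, List.take_prefix _ _, ?_⟩
  rw [comp_take]
  exact List.prefix_iff_eq_take.1 h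

/-- `D_n` consists of the words of length `2n+1` and height `-1` whose proper prefixes have
nonnegative height. -/
theorem inD_iff (n : ℕ) (w : Word) :
    InD n w ↔ w.length = 2 * n + 1 ∧ delta w = -1 ∧
      ∀ p, p <+: w → p ≠ w → 0 ≤ delta p := by
  constructor
  · rintro ⟨d, ⟨hd, hp⟩, hl, rfl⟩
    refine ⟨by simp [hl], by rw [delta_append, hd]; rfl, fun p h hne => ?_⟩
    rcases exists_of_prefix_append h with ⟨h, -⟩ | ⟨q, hq, rfl⟩
    · exact hp p h
    · obtain rfl | rfl : q = [] ∨ q = [Letter.b] := by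
        rcases q with _ | ⟨x, q⟩
        · exact Or.inl rfl
        · simp_all
      · simp [hd]
      · exact absurd rfl hne
  · rintro ⟨hl, hd, hp⟩
    rcases List.eq_nil_or_concat w with rfl | ⟨d, x, rfl⟩
    · simp at hl
    · rw [List.concat_eq_append] at *
      have h0 := hp d (List.prefix_append _ _) (by simp)
      rw [delta_append] at hd
      cases x with
      | a => rw [show delta [Letter.a] = 1 from rfl] at hd; omega
      | b =>
        rw [show delta [Letter.b] = -1 from rfl] at hd
        refine ⟨d, ⟨by omega, fun p h => hp p (h.trans (List.prefix_append _ _)) ?_⟩,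
          by simpa using hl, rfl⟩
        rintro rfl
        simpa using h.length_le

/-! ### Principal prefixes and the map `gammaFun` -/

theorem IsPrincipalPrefix.delta_lt {u w p : Word} (h : IsPrincipalPrefix u w) (hp : p <+: u)
    (hne : p ≠ u) : delta p < delta u := by
  refine lt_of_le_of_ne (h.2.1 p (hp.trans h.1)) fun he => hne ?_
  exact hp.eq_of_length_le (h.2.2 p (hp.trans h.1) he)

theorem IsPrincipalPrefix.of_delta_lt {u w : Word} (h : u <+: w)
    (hmax : ∀ p, p <+: w → delta p ≤ delta u)
    (hlt : ∀ p, p <+: u → p ≠ u → delta p < delta u) : IsPrincipalPrefix u w := by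
  refine ⟨h, hmax, fun p hp he => ?_⟩
  by_contra hl
  have hpu := List.prefix_of_prefix_length_le hp h (by omega)
  exact absurd he (hlt p hpu (by rintro rfl; exact hl le_rfl)).ne

theorem exists_isPrincipalPrefix (w : Word) : ∃ u, IsPrincipalPrefix u w := by
  obtain ⟨k, -, hk⟩ := Finset.exists_max_image (Finset.range (w.length + 1))
    (fun i => delta (w.take i)) ⟨0, by simp⟩
  have hne : {k : ℕ | ∀ i ≤ w.length, delta (w.take i) ≤ delta (w.take k)}.Nonempty :=
    ⟨k, fun i hi => hk i (by simp; omega)⟩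
  have hmem := Nat.sInf_mem hne
  have hmax : ∀ p, p <+: w → delta p ≤ delta (w.take (ppLen w)) := by
    intro p hp
    have := hmem p.length hp.length_le
    rwa [← List.prefix_iff_eq_take.1 hp] at this
  refine ⟨w.take (ppLen w), List.take_prefix _ _, hmax, fun p hp he => ?_⟩
  refine le_trans (List.length_take_le _ _) (Nat.sInf_le fun i _ => ?_)
  rw [← List.prefix_iff_eq_take.1 hp, he]
  exact hmax _ (List.take_prefix _ _)

theorem IsPrincipalPrefix.ppLen_eq {u w : Word} (h : IsPrincipalPrefix u w) :
    ppLen w = u.length := by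
  have hu := List.prefix_iff_eq_take.1 h.1
  have hmem : u.length ∈ {k : ℕ | ∀ i ≤ w.length, delta (w.take i) ≤ delta (w.take k)} := by
    intro i _
    rw [← hu]
    exact h.2.1 _ (List.take_prefix _ _)
  refine le_antisymm (Nat.sInf_le hmem) ?_
  have hs := Nat.sInf_mem ⟨_, hmem⟩
  refine le_trans (h.2.2 (w.take (ppLen w)) (List.take_prefix _ _) ?_) (List.length_take_le _ _)
  refine le_antisymm (h.2.1 _ (List.take_prefix _ _)) ?_
  have := hs u.length h.1.length_le
  rwa [← hu] at this

theorem IsPrincipalPrefix.gammaFun_eq {u v : Word} {x : Letter}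
    (h : IsPrincipalPrefix u (u ++ v ++ [x])) :
    gammaFun (u ++ v ++ [x]) = comp v ++ [Letter.b] ++ comp u := by
  rw [gammaFun, h.ppLen_eq]
  simp

theorem InD.exists_split {n : ℕ} {w : Word} (hw : InD n w) :
    ∃ u v, w = u ++ v ++ [Letter.b] ∧ IsPrincipalPrefix u w := by
  obtain ⟨u, hu⟩ := exists_isPrincipalPrefix w
  obtain ⟨-, hd, -⟩ := (inD_iff n w).1 hw
  obtain ⟨d, -, -, rfl⟩ := hw
  rcases exists_of_prefix_append hu.1 with ⟨⟨v, rfl⟩, -⟩ | ⟨q, hq, rfl⟩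
  · exact ⟨u, v, rfl, hu⟩
  · obtain rfl | rfl : q = [] ∨ q = [Letter.b] := by
      rcases q with _ | ⟨x, q⟩
      · exact Or.inl rfl
      · simp_all
    · exact ⟨d, [], by simp, by simpa using hu⟩
    · have := hu.2.1 [] List.nil_prefix
      rw [delta_nil] at this
      omega

theorem InD.gammaFun_mem {n : ℕ} {w : Word} (hw : InD n w) : InD n (gammaFun w) := by
  obtain ⟨u, v, rfl, hu⟩ := hw.exists_split
  rw [hu.gammaFun_eq]
  rw [inD_iff] at hw ⊢
  obtain ⟨hl, hd, -⟩ := hw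
  have hb : delta [Letter.b] = -1 := rfl
  simp only [delta_append, delta_comp, hb] at hd ⊢
  refine ⟨by simp [length_comp] at hl ⊢; omega, by omega, fun p hp hne => ?_⟩
  rw [List.append_assoc] at hp hne
  rcases exists_of_prefix_append hp with ⟨hp, -⟩ | ⟨q, hq, rfl⟩
  · obtain ⟨q, hq, rfl⟩ := exists_of_prefix_comp hp
    have := hu.2.1 (u ++ q) (by
      rw [List.append_assoc, List.prefix_append_right_inj]
      exact hq.trans (List.prefix_append _ _))
    rw [delta_append] at this
    rw [delta_comp]
    omega
  · rcases q with _ | ⟨x, q⟩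
    · have := hu.2.1 [] List.nil_prefix
      rw [delta_nil] at this
      rw [List.append_nil, delta_comp]
      omega
    · rw [List.singleton_append, List.cons_prefix_cons] at hq
      obtain ⟨rfl, hq⟩ := hq
      obtain ⟨r, hr, rfl⟩ := exists_of_prefix_comp hq
      have := hu.delta_lt hr (by rintro rfl; simp at hne)
      rw [delta_append, delta_cons_b, delta_comp, delta_comp]
      omega

/-! ### Inserting factors `ab` -/

/-- The number of factors `ab` that must separate the consecutive letters `x`, `y`. -/
def peak : Letter → Letter → ℕ
  | .a, .b => 1
  | _, _ => 0

/-- Insert before each letter the prescribed number of factors `ab`, and one more at each factor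
`ab` of the original word, which is preceded by the letter `x`. -/
def insertPeaks : Letter → List (Letter × ℕ) → Word
  | _, [] => []
  | x, (y, m) :: z => wpow [Letter.a, Letter.b] (m + peak x y) ++ y :: insertPeaks y z

/-- The last letter of a word preceded by the letter `x`. -/
def lastLetter : Letter → List (Letter × ℕ) → Letter
  | x, [] => x
  | _, (y, _) :: z => lastLetter y z

/-- Exchange the letters `a` and `b` in a decorated word. -/
def flipPairs (z : List (Letter × ℕ)) : List (Letter × ℕ) := z.map fun y => (y.1.flip, y.2)

theorem insertPeaks_append (x : Letter) (z z' : List (Letter × ℕ)) :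
    insertPeaks x (z ++ z') = insertPeaks x z ++ insertPeaks (lastLetter x z) z' := by
  induction z generalizing x with
  | nil => rfl
  | cons y z ih => simp [insertPeaks, lastLetter, ih]

theorem lastLetter_concat (x : Letter) (z : List (Letter × ℕ)) (y : Letter × ℕ) :
    lastLetter x (z ++ [y]) = y.1 := by
  induction z generalizing x with
  | nil => rfl
  | cons y z ih => simpa [lastLetter] using ih _

theorem lastLetter_append (x : Letter) (z z' : List (Letter × ℕ)) :
    lastLetter x (z ++ z') = lastLetter (lastLetter x z) z' := by
  induction z generalizing x with
  | nil => rfl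
  | cons y z ih => simpa [lastLetter] using ih _

theorem lastLetter_flipPairs (x : Letter) (z : List (Letter × ℕ)) :
    lastLetter x.flip (flipPairs z) = (lastLetter x z).flip := by
  induction z generalizing x with
  | nil => rfl
  | cons y z ih => simpa [lastLetter, flipPairs] using ih _

theorem delta_wpow (k : ℕ) : delta (wpow [Letter.a, Letter.b] k) = 0 := by
  induction k with
  | zero => rfl
  | succ k ih => simp [wpow, delta_cons_a, delta_cons_b, ih]

theorem delta_prefix_wpow_le (k : ℕ) {p : Word} (hp : p <+: wpow [Letter.a, Letter.b] k) :
    delta p ≤ 1 := by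
  induction k generalizing p with
  | zero => simp [wpow] at hp; simp [hp, delta_nil]
  | succ k ih =>
    rcases p with _ | ⟨x, _ | ⟨y, p⟩⟩
    · simp [delta_nil]
    · cases x <;> simp [delta_cons_a, delta_cons_b, delta_nil]
    · simp only [wpow, List.cons_append, List.nil_append, List.cons_prefix_cons] at hp
      obtain ⟨rfl, rfl, hp⟩ := hp
      have := ih hp
      rw [delta_cons_a, delta_cons_b]
      omega

theorem delta_insertPeaks (x : Letter) (z : List (Letter × ℕ)) :
    delta (insertPeaks x z) = delta (z.map Prod.fst) := by
  induction z generalizing x with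
  | nil => rfl
  | cons y z ih =>
    obtain ⟨y, m⟩ := y
    cases y <;> simp [insertPeaks, delta_append, delta_wpow, delta_cons_a, delta_cons_b, ih]

/-- A proper prefix of a word with inserted factors exceeds some proper prefix of the original
word by at most one in height. -/
theorem delta_prefix_insertPeaks_le (x : Letter) (z : List (Letter × ℕ)) {p : Word}
    (hp : p <+: insertPeaks x z) : p = insertPeaks x z ∨
      ∃ q, q <+: z.map Prod.fst ∧ q ≠ z.map Prod.fst ∧ delta p ≤ delta q + 1 := by
  induction z generalizing x p with
  | nil => left; simpa [insertPeaks] using hp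
  | cons y z ih =>
    obtain ⟨y, m⟩ := y
    have hnil : delta p ≤ 1 → ∃ q, q <+: ((y, m) :: z).map Prod.fst ∧
        q ≠ ((y, m) :: z).map Prod.fst ∧ delta p ≤ delta q + 1 :=
      fun h => ⟨[], List.nil_prefix, by simp, by simpa [delta_nil] using h⟩
    rw [insertPeaks] at hp ⊢
    rcases exists_of_prefix_append hp with ⟨hp, -⟩ | ⟨q, hq, rfl⟩
    · exact Or.inr (hnil (delta_prefix_wpow_le _ hp))
    · rcases q with _ | ⟨c, q⟩
      · exact Or.inr (hnil (by simp [delta_wpow]))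
      · rw [List.cons_prefix_cons] at hq
        obtain ⟨rfl, hq⟩ := hq
        rcases ih c hq with rfl | ⟨r, hr, hne, hle⟩
        · exact Or.inl rfl
        · refine Or.inr ⟨c :: r, by simpa using hr, by simpa using hne, ?_⟩
          rw [delta_append, delta_wpow]
          cases c <;> simp only [delta_cons_a, delta_cons_b] <;> omega

theorem cons_comp_wpow (k : ℕ) (t : Word) :
    Letter.a :: (comp (wpow [Letter.a, Letter.b] k) ++ t) =
      wpow [Letter.a, Letter.b] k ++ Letter.a :: t := by
  induction k with
  | zero => rfl
  | succ k ih => simp [wpow, comp, Letter.flip] at ih ⊢; exact ih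

theorem comp_wpow_append (k : ℕ) (t : Word) :
    comp (wpow [Letter.a, Letter.b] k) ++ Letter.b :: t =
      Letter.b :: (wpow [Letter.a, Letter.b] k ++ t) := by
  induction k with
  | zero => rfl
  | succ k ih => simp [wpow, comp, Letter.flip] at ih ⊢; exact ih

/-- The word `a` if the letter is `b`, and the empty word otherwise. -/
def onlyB : Letter → Word
  | .a => []
  | .b => [Letter.a]

/-- The word `b` if the letter is `a`, and the empty word otherwise. -/
def onlyA : Letter → Word
  | .a => [Letter.b]
  | .b => []

/-- Deleting one letter from each run can be done by deleting factors `ab` or factors `ba`: the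
complement of a word with inserted factors is, up to its two ends, the complemented word with the
same insertions. -/
theorem comp_insertPeaks (x : Letter) (z : List (Letter × ℕ)) :
    onlyB x ++ comp (insertPeaks x z) ++ onlyA (lastLetter x z) =
      onlyA x ++ insertPeaks x.flip (flipPairs z) ++ onlyB (lastLetter x z) := by
  induction z generalizing x with
  | nil => cases x <;> rfl
  | cons y z ih =>
    obtain ⟨y, m⟩ := y
    have h := ih y
    cases x <;> cases y <;>
      simp only [onlyA, onlyB, lastLetter, flipPairs, List.map_cons, insertPeaks, peak, comp_append,
        comp_cons, Letter.flip, wpow, add_zero, List.append_assoc, List.nil_append,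
        List.cons_append, comp_wpow_append, cons_comp_wpow] at h ⊢ <;>
      simp only [h]

theorem insertPeaks_singleton_b (k : ℕ) :
    insertPeaks .b [(Letter.b, k)] = wpow [Letter.a, Letter.b] k ++ [Letter.b] := rfl

theorem gammaFun_wpow (k : ℕ) :
    gammaFun (wpow [Letter.a, Letter.b] k ++ [Letter.b]) =
      wpow [Letter.a, Letter.b] k ++ [Letter.b] := by
  have hmax : ∀ p, p <+: wpow [Letter.a, Letter.b] k ++ [Letter.b] → delta p ≤ 1 := by
    intro p hp
    rw [← insertPeaks_singleton_b] at hp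
    rcases delta_prefix_insertPeaks_le _ _ hp with rfl | ⟨q, hq, hne, hle⟩
    · rw [delta_insertPeaks]
      simp [delta_cons_b, delta_nil]
    · rcases q with _ | ⟨x, q⟩
      · simpa [delta_nil] using hle
      · simp_all
  cases k with
  | zero =>
    have h : IsPrincipalPrefix [] ([] ++ [] ++ [Letter.b]) := by
      refine .of_delta_lt List.nil_prefix (fun p hp => ?_) (fun p hp hne => ?_)
      · rcases p with _ | ⟨x, p⟩
        · rfl
        · simp only [List.nil_append, List.cons_prefix_cons, List.prefix_nil] at hp
          obtain ⟨rfl, rfl⟩ := hp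
          simp [delta_cons_b, delta_nil]
      · exact absurd (List.prefix_nil.1 hp) hne
    exact h.gammaFun_eq
  | succ k =>
    have e : wpow [Letter.a, Letter.b] (k + 1) ++ [Letter.b] =
        [Letter.a] ++ Letter.b :: wpow [Letter.a, Letter.b] k ++ [Letter.b] := by simp [wpow]
    have h : IsPrincipalPrefix [Letter.a]
        ([Letter.a] ++ Letter.b :: wpow [Letter.a, Letter.b] k ++ [Letter.b]) := by
      rw [← e]
      refine .of_delta_lt (by simp [wpow]) hmax (fun p hp hne => ?_)
      rcases p with _ | ⟨x, p⟩
      · decide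
      · simp_all
    rw [e, h.gammaFun_eq]
    simp only [comp_cons, comp_nil, Letter.flip, List.cons_append, List.append_assoc,
      List.nil_append, cons_comp_wpow]
    rw [← comp_wpow_append, cons_comp_wpow]

theorem gammaFun_insertPeaks_append {n k : ℕ} {s t : List (Letter × ℕ)}
    (hD : InD n ((s ++ t ++ [(Letter.b, k)]).map Prod.fst))
    (hs : IsPrincipalPrefix (s.map Prod.fst) ((s ++ t ++ [(Letter.b, k)]).map Prod.fst)) :
    gammaFun (insertPeaks .b (s ++ t ++ [(Letter.b, k)])) =
      insertPeaks .b (flipPairs t ++ [(Letter.b, k)] ++ flipPairs s) := by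
  obtain ⟨-, hd, hpos⟩ := (inD_iff _ _).1 hD
  simp only [List.map_append, List.map_cons, List.map_nil, delta_append, delta_cons_b,
    delta_nil] at hd hpos hs
  rcases s with _ | ⟨⟨c, i⟩, s⟩
  · obtain rfl : t = [] := by
      rcases t with _ | ⟨⟨c, j⟩, t⟩
      · rfl
      · cases c with
        | a =>
          have := hs.2.1 [Letter.a] (by simp)
          simp [delta_cons_a, delta_nil] at this
        | b =>
          have := hpos [Letter.b] (by simp) (by simp)
          simp [delta_cons_b, delta_nil] at this
    exact gammaFun_wpow k
  obtain rfl : c = .a := by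
    cases c with
    | a => rfl
    | b =>
      have := hpos [Letter.b] (by simp) (by simp)
      simp [delta_cons_b, delta_nil] at this
  generalize hz : (Letter.a, i) :: s = z at *
  have hz1 : 0 < delta (z.map Prod.fst) :=
    hs.delta_lt (p := []) List.nil_prefix (by simp [← hz])
  have hzl : ∀ x, lastLetter x z = .a := by
    intro x
    rcases List.eq_nil_or_concat z with rfl | ⟨r, ⟨c, j⟩, rfl⟩
    · simp at hz
    · rw [List.concat_eq_append] at *
      rw [lastLetter_concat]
      cases c with
      | a => rfl
      | b =>
        have := hs.delta_lt (p := r.map Prod.fst) (by simp) (by simp)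
        simp only [List.map_append, List.map_cons, List.map_nil, delta_append, delta_cons_b,
          delta_nil] at this
        omega
  have hzb : insertPeaks .b z = insertPeaks .a z := by rw [← hz]; rfl
  have htl : ∀ x, lastLetter x t = .b := by
    intro x
    rcases List.eq_nil_or_concat t with rfl | ⟨r, ⟨c, j⟩, rfl⟩
    · simp [delta_nil] at hd; omega
    · rw [List.concat_eq_append] at *
      rw [lastLetter_concat]
      cases c with
      | b => rfl
      | a =>
        have := hpos (z.map Prod.fst ++ r.map Prod.fst) (by simp) (by simp)
        simp only [List.map_append, List.map_cons, List.map_nil, delta_append, delta_cons_a,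
          delta_nil] at this hd
        omega
  obtain ⟨r, hr⟩ : ∃ r, insertPeaks .a t = Letter.a :: r := by
    rcases t with _ | ⟨⟨c, j⟩, t⟩
    · exact absurd (htl .a) (by simp [lastLetter])
    · cases c with
      | b => exact ⟨_, rfl⟩
      | a =>
        have := hs.2.1 (z.map Prod.fst ++ [Letter.a]) (by simp)
        simp only [delta_append, delta_cons_a, delta_nil] at this
        omega
  have e : insertPeaks .b (z ++ t ++ [(Letter.b, k)]) =
      (insertPeaks .b z ++ [Letter.a]) ++ (r ++ wpow [Letter.a, Letter.b] k) ++ [Letter.b] := by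
    rw [insertPeaks_append, insertPeaks_append, lastLetter_append, hzl, htl, hr,
      insertPeaks_singleton_b]
    simp
  have hpp : IsPrincipalPrefix (insertPeaks .b z ++ [Letter.a])
      ((insertPeaks .b z ++ [Letter.a]) ++ (r ++ wpow [Letter.a, Letter.b] k) ++ [Letter.b]) := by
    have hdz : delta (insertPeaks .b z ++ [Letter.a]) = delta (z.map Prod.fst) + 1 := by
      rw [delta_append, delta_insertPeaks]
      rfl
    refine .of_delta_lt (by simp) (fun p hp => ?_) (fun p hp hne => ?_)
    · rw [hdz]
      rw [← e] at hp
      rcases delta_prefix_insertPeaks_le _ _ hp with rfl | ⟨q, hq, -, hle⟩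
      · rw [delta_insertPeaks]
        simp only [List.map_append, List.map_cons, List.map_nil, delta_append, delta_cons_b,
          delta_nil]
        omega
      · have := hs.2.1 q (by simpa using hq)
        omega
    · rw [hdz]
      rcases exists_of_prefix_append hp with ⟨hp, -⟩ | ⟨q, hq, rfl⟩
      · rcases delta_prefix_insertPeaks_le _ _ hp with rfl | ⟨q, hq, hne, hle⟩
        · rw [delta_insertPeaks]
          omega
        · have := hs.delta_lt hq hne
          omega
      · rcases q with _ | ⟨x, q⟩
        · rw [List.append_nil, delta_insertPeaks]
          omega
        · simp_all
  have hcz := comp_insertPeaks .a z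
  have hct := comp_insertPeaks .a t
  rw [hzl] at hcz
  rw [htl, hr] at hct
  simp only [onlyA, onlyB, Letter.flip, comp_cons, List.nil_append, List.cons_append,
    List.append_nil, List.cons.injEq, true_and] at hcz hct
  have hlt : lastLetter .b (flipPairs t) = .a := by
    have := lastLetter_flipPairs .a t
    rwa [htl] at this
  have hlt' : lastLetter .b (flipPairs t ++ [(Letter.b, k)]) = .b := lastLetter_concat _ _ _
  rw [e, hpp.gammaFun_eq, insertPeaks_append, insertPeaks_append, hlt, hlt', hzb, comp_append,
    comp_append, hct]
  simp only [insertPeaks, peak, comp_cons, comp_nil, Letter.flip, hcz, List.append_assoc,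
    List.nil_append, List.cons_append, cons_comp_wpow, wpow]
  rw [← cons_comp_wpow, comp_wpow_append]

theorem flipPairs_zip (w : Word) (m : List ℕ) : flipPairs (w.zip m) = (comp w).zip m := by
  rw [flipPairs, comp, List.zip_map_left]
  rfl

/-- Inserting factors `ab` commutes with the map `gammaFun`. -/
theorem gammaFun_insertPeaks {n : ℕ} {w : Word} {m : List ℕ} (hw : InD n w)
    (hm : m.length = w.length) :
    gammaFun (insertPeaks .b (w.zip m)) =
      insertPeaks .b ((gammaFun w).zip (m.rotate (ppLen w))) := by
  obtain ⟨u, v, rfl, hu⟩ := hw.exists_split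
  obtain ⟨mu, mv, k, rfl, hmu, hmv⟩ : ∃ mu mv k, m = mu ++ mv ++ [k] ∧
      u.length = mu.length ∧ v.length = mv.length := by
    rcases List.eq_nil_or_concat m with rfl | ⟨m, k, rfl⟩
    · simp at hm
    · simp only [List.concat_eq_append, List.length_append, List.length_singleton] at hm
      exact ⟨m.take u.length, m.drop u.length, k, by simp, by simp; omega, by simp; omega⟩
  have hfst : ((u.zip mu ++ v.zip mv ++ [(Letter.b, k)]).map Prod.fst) = u ++ v ++ [Letter.b] := by
    simp [List.map_fst_zip, hmu.le, hmv.le]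
  have hz : (u ++ v ++ [Letter.b]).zip (mu ++ mv ++ [k]) =
      u.zip mu ++ v.zip mv ++ [(Letter.b, k)] := by
    rw [List.zip_append (by simp [hmu, hmv]), List.zip_append hmu]
    rfl
  rw [hz, gammaFun_insertPeaks_append (n := n) (by rwa [hfst])
    (by rw [hfst, List.map_fst_zip hmu.le]; exact hu), hu.gammaFun_eq, hu.ppLen_eq, hmu,
    List.append_assoc mu, List.rotate_append_length_eq,
    List.zip_append (by simp [length_comp, hmv]), List.zip_append (by simp [length_comp, hmv]),
    flipPairs_zip, flipPairs_zip]
  rfl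

theorem insertPeaks_succ (x y : Letter) (m : ℕ) (z : List (Letter × ℕ)) :
    insertPeaks x ((y, m + 1) :: z) = Letter.a :: Letter.b :: insertPeaks x ((y, m) :: z) := by
  rw [insertPeaks, insertPeaks, Nat.add_right_comm]
  rfl

/-- Every word that ends in `b` but not in `ab` is obtained by insertions of factors `ab`. -/
theorem exists_insertPeaks (w : Word) (hb : w.getLast? = some .b)
    (hab : ¬ [Letter.a, Letter.b] <:+ w) :
    (∃ z, w = insertPeaks .b z) ∧ (w.head? = some .a → ∃ z, w = insertPeaks .a z) := by
  have hsuf : ∀ {x : Letter} {r : Word}, r <:+ x :: r := fun {x r} => List.suffix_cons x r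
  induction hl : w.length using Nat.strong_induction_on generalizing w with
  | _ l ih =>
  subst hl
  match w, hb, hab, ih with
  | [], hb, _, _ => simp at hb
  | .b :: r, hb, hab, ih =>
    refine ⟨?_, by simp⟩
    rcases r with _ | ⟨c, r⟩
    · exact ⟨[(.b, 0)], rfl⟩
    · obtain ⟨⟨z, hz⟩, -⟩ := ih (c :: r).length (by simp) (c :: r) (by simpa using hb)
        (fun h => hab (h.trans hsuf)) rfl
      exact ⟨(.b, 0) :: z, by rw [hz]; rfl⟩
  | [.a], hb, _, _ => simp at hb
  | .a :: .a :: r, hb, hab, ih =>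
    obtain ⟨z, hz⟩ := (ih (.a :: r : Word).length (by simp) (.a :: r) (by simpa using hb)
      (fun h => hab (h.trans hsuf)) rfl).2 rfl
    exact ⟨⟨(.a, 0) :: z, by rw [hz]; rfl⟩, fun _ => ⟨(.a, 0) :: z, by rw [hz]; rfl⟩⟩
  | [.a, .b], _, hab, _ => exact absurd List.suffix_rfl hab
  | .a :: .b :: c :: r, hb, hab, ih =>
    have ihr := ih (c :: r).length (by simp) (c :: r) (by simpa using hb)
      (fun h => hab (h.trans (hsuf.trans hsuf))) rfl
    have hinc : ∀ x, (∃ z, c :: r = insertPeaks x z) →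
        ∃ z, .a :: .b :: c :: r = insertPeaks x z := by
      rintro x ⟨_ | ⟨⟨y, m⟩, z⟩, hz⟩
      · simp [insertPeaks] at hz
      · exact ⟨(y, m + 1) :: z, by rw [insertPeaks_succ, hz]⟩
    refine ⟨hinc .b ihr.1, fun _ => ?_⟩
    cases c with
    | a => exact hinc .a (ihr.2 rfl)
    | b =>
      rcases r with _ | ⟨c, r⟩
      · exact ⟨[(.b, 0)], rfl⟩
      · obtain ⟨⟨z, hz⟩, -⟩ := ih (c :: r).length (by simp) (c :: r) (by simpa using hb)
          (fun h => hab (h.trans (hsuf.trans (hsuf.trans hsuf)))) rfl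
        exact ⟨(.b, 0) :: z, by rw [hz]; rfl⟩

theorem length_le_insertPeaks (x : Letter) (z : List (Letter × ℕ)) :
    z.length ≤ (insertPeaks x z).length := by
  induction z generalizing x with
  | nil => simp
  | cons y z ih =>
    have := ih y.1
    simp only [insertPeaks, List.length_append, List.length_cons]
    omega

/-- If nothing is inserted into a word preceded by `a`, then it contains no letter `b`. -/
theorem delta_of_length_insertPeaks_le {z : List (Letter × ℕ)}
    (h : (insertPeaks .a z).length ≤ z.length) : delta (insertPeaks .a z) = z.length := by
  induction z with
  | nil => rfl
  | cons y z ih =>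
    obtain ⟨y, m⟩ := y
    have hl := length_le_insertPeaks y z
    rw [insertPeaks] at h ⊢
    simp only [List.length_append, List.length_cons] at h
    cases y with
    | a =>
      rw [delta_append, delta_wpow, delta_cons_a, ih (by omega)]
      simp
    | b =>
      simp only [peak, wpow, List.length_append, List.length_cons] at h
      omega

/-- Every word of `D_n` with `n ≥ 1` arises from a shorter word of some `D_k` by insertions. -/
theorem InD.exists_insertPeaks {n : ℕ} (hn : 1 ≤ n) {w : Word} (hw : InD n w) :
    ∃ k < n, ∃ (w' : Word) (m : List ℕ), InD k w' ∧ m.length = w'.length ∧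
      w = insertPeaks .b (w'.zip m) := by
  obtain ⟨hl, hd, hp⟩ := (inD_iff n w).1 hw
  have hab : ¬ [Letter.a, Letter.b] <:+ w := by
    rintro ⟨s, rfl⟩
    have := hp s (List.prefix_append _ _) (by simp)
    simp only [delta_append, delta_cons_a, delta_cons_b, delta_nil] at hd
    omega
  have hb : w.getLast? = some .b := by
    obtain ⟨d, -, -, rfl⟩ := hw
    simp
  obtain ⟨⟨z, rfl⟩, -⟩ := _root_.exists_insertPeaks w hb hab
  have hlen := length_le_insertPeaks .b z
  have hlt : z.length < 2 * n + 1 := by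
    by_contra hge
    rcases z with _ | ⟨⟨y, m⟩, z⟩
    · simp at hge
    · have hl' := length_le_insertPeaks y z
      simp only [insertPeaks, List.length_append, List.length_cons] at hl hge
      cases y with
      | b =>
        have := hp (wpow [Letter.a, Letter.b] (m + peak .b .b) ++ [Letter.b])
          (by simp [insertPeaks]) (by
            intro h
            have := congrArg List.length h
            simp only [insertPeaks, List.length_append, List.length_cons, List.length_nil] at this
            omega)
        simp [delta_append, delta_wpow, delta_cons_b, delta_nil] at this
      | a =>
        have := delta_of_length_insertPeaks_le (z := z) (by omega)
        rw [insertPeaks, delta_append, delta_wpow, delta_cons_a, this] at hd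
        omega
  have hd' : delta (z.map Prod.fst) = -1 := by rw [← delta_insertPeaks .b, hd]
  have hpar := delta_emod_two (z.map Prod.fst)
  rw [hd', List.length_map] at hpar
  refine ⟨(z.length - 1) / 2, by omega, z.map Prod.fst, z.map Prod.snd, ?_, by simp, ?_⟩
  · rw [inD_iff]
    refine ⟨by rw [List.length_map]; omega, hd', fun q hq hne => ?_⟩
    obtain ⟨t, ht⟩ := hq
    obtain ⟨z₁, z₂, rfl, rfl, rfl⟩ := List.map_eq_append_iff.1 ht.symm
    rw [← delta_insertPeaks .b]
    refine hp _ (by rw [insertPeaks_append]; exact List.prefix_append _ _) fun h => hne ?_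
    have h2 := length_le_insertPeaks (lastLetter .b z₁) z₂
    rw [insertPeaks_append, List.self_eq_append_right] at h
    rw [h, List.length_nil, Nat.le_zero, List.length_eq_zero_iff] at h2
    simp [h2]
  · rw [← List.unzip_fst, ← List.unzip_snd, List.zip_unzip]

/-! ### Odd periods -/

/-- The total rotation in the first `k` applications of `gammaFun` to `w`. -/
noncomputable def totalShift (w : Word) (k : ℕ) : ℕ :=
  ∑ j ∈ Finset.range k, ppLen (gammaFun^[j] w)

theorem InD.iterate {n : ℕ} {w : Word} (hw : InD n w) (k : ℕ) : InD n (gammaFun^[k] w) := by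
  induction k with
  | zero => exact hw
  | succ k ih => rw [Function.iterate_succ_apply']; exact ih.gammaFun_mem

theorem iterate_insertPeaks {n : ℕ} {w : Word} {m : List ℕ} (hw : InD n w)
    (hm : m.length = w.length) (k : ℕ) :
    gammaFun^[k] (insertPeaks .b (w.zip m)) =
      insertPeaks .b ((gammaFun^[k] w).zip (m.rotate (totalShift w k))) := by
  induction k with
  | zero => simp [totalShift]
  | succ k ih =>
    have hk := hw.iterate k
    rw [Function.iterate_succ_apply', Function.iterate_succ_apply', ih,
      gammaFun_insertPeaks hk, List.rotate_rotate, totalShift, totalShift, Finset.sum_range_succ]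
    rw [List.length_rotate, hm, ((inD_iff n _).1 hk).1, ((inD_iff n _).1 hw).1]

theorem totalShift_mul {w : Word} {k : ℕ} (hk : gammaFun^[k] w = w) (l : ℕ) :
    totalShift w (k * l) = l * totalShift w k := by
  have hper : ∀ l, gammaFun^[k * l] w = w := fun l => by
    rw [Function.iterate_mul]
    exact Function.iterate_fixed hk l
  induction l with
  | zero => simp [totalShift]
  | succ l ih =>
    rw [Nat.mul_succ, totalShift, Finset.sum_range_add, Nat.succ_mul, ← ih, totalShift, totalShift]
    congr 1
    refine Finset.sum_congr rfl fun j _ => ?_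
    rw [Nat.add_comm, Function.iterate_add_apply, hper]

theorem InD.exists_odd_period {n : ℕ} {w : Word} (hw : InD n w) :
    ∃ k, Odd k ∧ gammaFun^[k] w = w := by
  induction n using Nat.strong_induction_on generalizing w with
  | _ n ih =>
    rcases Nat.eq_zero_or_pos n with rfl | hn
    · obtain ⟨d, -, hd, rfl⟩ := hw
      obtain rfl : d = [] := by simpa using hd
      exact ⟨1, odd_one, gammaFun_wpow 0⟩
    · obtain ⟨i, hi, w', m, hw', hm, rfl⟩ := hw.exists_insertPeaks hn
      obtain ⟨k, hk, hkw⟩ := ih i hi hw'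
      have hlen : m.length = 2 * i + 1 := by rw [hm, ((inD_iff i _).1 hw').1]
      refine ⟨k * (2 * i + 1), hk.mul (by simp), ?_⟩
      rw [iterate_insertPeaks hw' hm, totalShift_mul hkw, ← hlen, List.rotate_length_mul,
        Function.iterate_mul, Function.iterate_fixed hkw]

/-- Every cycle of the permutation γ has odd cardinality: for every n ≥ 1 and
    w ∈ D_n there is k ≥ 1 with γ^[k] w = w, and the least such k is odd. -/
theorem gamma_cycles_odd (n : ℕ) (hn : 1 ≤ n) (w : Word) (hw : InD n w) :
    ∃ k : ℕ, 1 ≤ k ∧ gammaFun^[k] w = w ∧ Odd k ∧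
      ∀ m : ℕ, 1 ≤ m → gammaFun^[m] w = w → k ≤ m := by
  obtain ⟨k, hk, hkw⟩ := hw.exists_odd_period
  have hper : Function.IsPeriodicPt gammaFun k w := hkw
  refine ⟨Function.minimalPeriod gammaFun w, hper.minimalPeriod_pos hk.pos,
    Function.isPeriodicPt_minimalPeriod _ _, hk.of_dvd_nat hper.minimalPeriod_dvd,
    fun m hm h => Function.IsPeriodicPt.minimalPeriod_le hm h⟩
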